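/- arXiv:1001.4548 — 2 statements merged into one kernel-verified Lean document; each statement's English description precedes it below -/
import Mathlib

section
/- For every m ≥ 1, M = 2^m, every binary labeling L of order m, and every M×N real input alphabet X with Es > 0, the constellation [X, L, U_M] is first-order optimal (α(X,L) = log₂ e) if and only if there exists an m×N real matrix V such that X = Q(L)·V; that is, if and only if the rows of X are x_i = Σ_{k=0}^{m−1} q_{i,k} v_k for some vectors v_0,…,v_{m−1} ∈ ℝ^N (a linear projection of a hypercube). -/
/-- Modified labeling matrix: `q_{i,k} = -1` if `c_{i,m-1-k} = 1`, `+1` otherwise. -/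
def Qmat (m : ℕ) (c : ℕ → ℕ → Bool) (i k : ℕ) : ℝ :=
  if c i (m - 1 - k) then -1 else 1

theorem Qmat_orth (m : ℕ) (c : ℕ → ℕ → Bool)
    (hc : ∀ i < 2^m, ∀ j < 2^m, (∀ k < m, c i k = c j k) → i = j)
    (k l : ℕ) (hk : k < m) (hl : l < m) :
    ∑ i ∈ Finset.range (2^m), Qmat m c i k * Qmat m c i l = if k = l then (2^m : ℝ) else 0 := by
  split_ifs with h
  · subst h
    have : ∀ i ∈ Finset.range (2^m), Qmat m c i k * Qmat m c i k = 1 := by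
      intro i _
      unfold Qmat
      split_ifs <;> norm_num
    rw [Finset.sum_congr rfl this]
    simp
  · let e : Fin (2^m) → (Fin m → Bool) := fun i k => c i k
    have hinj : Function.Injective e := by
      intro i j hij
      apply Fin.ext
      apply hc i i.2 j j.2
      intro k hk
      exact congrFun hij ⟨k, hk⟩
    have hbij : Function.Bijective e := by
      rw [Fintype.bijective_iff_injective_and_card]
      exact ⟨hinj, by simp⟩
    let k' : Fin m := ⟨m - 1 - k, by omega⟩
    let l' : Fin m := ⟨m - 1 - l, by omega⟩
    have hkl : l' ≠ k' := by
      intro h'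
      have := congrArg Fin.val h'
      simp only [k', l'] at this
      omega
    let g : (Fin m → Bool) → ℝ := fun b =>
      (if b k' then -1 else 1) * (if b l' then -1 else 1)
    have h1 : ∑ i ∈ Finset.range (2^m), Qmat m c i k * Qmat m c i l = ∑ b, g b := by
      rw [Finset.sum_range]
      exact Function.Bijective.sum_comp hbij g
    let f : (Fin m → Bool) → (Fin m → Bool) := fun b => Function.update b k' (!b k')
    have hf : Function.Involutive f := by
      intro b
      simp [f]
    have h2 : ∑ b, g (f b) = ∑ b, g b := Function.Bijective.sum_comp hf.bijective g
    have h3 : ∀ b, g (f b) = - g b := by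
      intro b
      simp only [g, f, Function.update_self, Function.update_of_ne hkl]
      cases b k' <;> cases b l' <;> norm_num
    simp only [h3, Finset.sum_neg_distrib] at h2
    rw [h1]
    linarith

/-- A constellation `[X, L, U_M]` is first-order optimal (`α(X,L) = log₂ e`) if and
only if `X = Q(L)·V` for some `m×N` real matrix `V`, i.e., `X` is a linear projection
of a hypercube. -/
theorem foo_iff_hypercube_projection (m N : ℕ) (hm : 1 ≤ m)
    (c : ℕ → ℕ → Bool)
    (hc : ∀ i < 2^m, ∀ j < 2^m, (∀ k < m, c i k = c j k) → i = j)
    (x : ℕ → EuclideanSpace ℝ (Fin N)) (Es : ℝ)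
    (hEs : Es = (2^m : ℝ)⁻¹ * ∑ i ∈ Finset.range (2^m), ‖x i‖^2)
    (hEspos : 0 < Es) :
    (Real.logb 2 (Real.exp 1) / Es) *
        ∑ k ∈ Finset.range m,
          ‖(2^m : ℝ)⁻¹ • ∑ i ∈ Finset.range (2^m), Qmat m c i k • x i‖^2
      = Real.logb 2 (Real.exp 1)
    ↔ ∃ v : ℕ → EuclideanSpace ℝ (Fin N),
        ∀ i < 2^m, x i = ∑ k ∈ Finset.range m, Qmat m c i k • v k := by
  have orth := Qmat_orth m c hc
  have hM : (0 : ℝ) < 2^m := by positivity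
  have hL : Real.logb 2 (Real.exp 1) ≠ 0 := by
    apply ne_of_gt
    apply Real.logb_pos (by norm_num)
    exact Real.one_lt_exp_iff.mpr one_pos
  set w : ℕ → EuclideanSpace ℝ (Fin N) := fun k =>
    (2^m : ℝ)⁻¹ • ∑ i ∈ Finset.range (2^m), Qmat m c i k • x i with hw
  have hsum : ∀ k, ∑ i ∈ Finset.range (2^m), Qmat m c i k • x i = (2^m : ℝ) • w k := by
    intro k
    simp only [hw]
    rw [smul_inv_smul₀ hM.ne']
  have key : ∑ i ∈ Finset.range (2^m), ‖x i - ∑ k ∈ Finset.range m, Qmat m c i k • w k‖^2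
      = ∑ i ∈ Finset.range (2^m), ‖x i‖^2 - 2^m * ∑ k ∈ Finset.range m, ‖w k‖^2 := by
    have hA : ∑ i ∈ Finset.range (2^m), inner ℝ (x i) (∑ k ∈ Finset.range m, Qmat m c i k • w k)
        = 2^m * ∑ k ∈ Finset.range m, ‖w k‖^2 := by
      simp only [inner_sum, inner_smul_right]
      rw [Finset.sum_comm, Finset.mul_sum]
      refine Finset.sum_congr rfl fun k _ => ?_
      have := congrArg (fun z => inner ℝ z (w k)) (hsum k)
      simp only [sum_inner, real_inner_smul_left, real_inner_self_eq_norm_sq] at this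
      exact this
    have hB : ∑ i ∈ Finset.range (2^m), ‖∑ k ∈ Finset.range m, Qmat m c i k • w k‖^2
        = 2^m * ∑ k ∈ Finset.range m, ‖w k‖^2 := by
      have : ∀ i, ‖∑ k ∈ Finset.range m, Qmat m c i k • w k‖^2 =
          ∑ k ∈ Finset.range m, ∑ l ∈ Finset.range m,
            (Qmat m c i k * Qmat m c i l) * inner ℝ (w k) (w l) := by
        intro i
        rw [← real_inner_self_eq_norm_sq, sum_inner]
        refine Finset.sum_congr rfl fun k _ => ?_
        rw [inner_sum]
        refine Finset.sum_congr rfl fun l _ => ?_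
        rw [real_inner_smul_left, real_inner_smul_right, mul_assoc]
      simp only [this]
      rw [Finset.sum_comm, Finset.mul_sum]
      refine Finset.sum_congr rfl fun k hk => ?_
      rw [Finset.sum_comm]
      have h2 : ∀ l ∈ Finset.range m, ∑ i ∈ Finset.range (2^m),
          (Qmat m c i k * Qmat m c i l) * inner ℝ (w k) (w l)
          = if k = l then 2^m * inner ℝ (w k) (w l) else 0 := by
        intro l hl
        rw [← Finset.sum_mul, orth k l (Finset.mem_range.1 hk) (Finset.mem_range.1 hl)]
        split_ifs <;> simp
      rw [Finset.sum_congr rfl h2, Finset.sum_ite_eq, if_pos hk, real_inner_self_eq_norm_sq]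
    simp only [norm_sub_sq_real, Finset.sum_add_distrib, Finset.sum_sub_distrib,
      ← Finset.mul_sum, hA, hB]
    ring
  have hEM : ∑ i ∈ Finset.range (2^m), ‖x i‖^2 = 2^m * Es := by
    rw [hEs, mul_inv_cancel_left₀ hM.ne']
  rw [hEM] at key
  have hstep : (Real.logb 2 (Real.exp 1) / Es) * ∑ k ∈ Finset.range m, ‖w k‖^2
      = Real.logb 2 (Real.exp 1) ↔ ∑ k ∈ Finset.range m, ‖w k‖^2 = Es := by
    rw [div_mul_eq_mul_div, div_eq_iff hEspos.ne']
    exact mul_right_inj' hL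
  refine hstep.trans ⟨fun h => ⟨w, ?_⟩, ?_⟩
  · rw [h, sub_self, Finset.sum_eq_zero_iff_of_nonneg (fun _ _ => by positivity)] at key
    intro i hi
    have := key i (Finset.mem_range.2 hi)
    exact sub_eq_zero.1 (norm_eq_zero.1 (pow_eq_zero_iff (two_ne_zero) |>.1 this))
  · rintro ⟨v, hv⟩
    have hwv : ∀ l ∈ Finset.range m, w l = v l := by
      intro l hl
      have h1 : (2^m : ℝ) • w l = (2^m : ℝ) • v l := by
        rw [← hsum]
        have h2 : ∀ i ∈ Finset.range (2^m), Qmat m c i l • x i =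
            ∑ k ∈ Finset.range m, (Qmat m c i l * Qmat m c i k) • v k := by
          intro i hi
          rw [hv i (Finset.mem_range.1 hi), Finset.smul_sum]
          simp only [smul_smul]
        rw [Finset.sum_congr rfl h2, Finset.sum_comm]
        have h3 : ∀ k ∈ Finset.range m, ∑ i ∈ Finset.range (2^m),
            (Qmat m c i l * Qmat m c i k) • v k = if l = k then (2^m : ℝ) • v k else 0 := by
          intro k hk
          rw [← Finset.sum_smul, orth l k (Finset.mem_range.1 hl) (Finset.mem_range.1 hk)]
          split_ifs <;> simp
        rw [Finset.sum_congr rfl h3, Finset.sum_ite_eq, if_pos hl]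
      exact smul_right_injective _ hM.ne' h1
    have hz : ∑ i ∈ Finset.range (2^m),
        ‖x i - ∑ k ∈ Finset.range m, Qmat m c i k • w k‖^2 = 0 := by
      refine Finset.sum_eq_zero fun i hi => ?_
      have : ∑ k ∈ Finset.range m, Qmat m c i k • w k = x i := by
        rw [hv i (Finset.mem_range.1 hi)]
        exact Finset.sum_congr rfl fun k hk => by rw [hwv k hk]
      rw [this]
      simp
    rw [hz] at key
    have : (2^m : ℝ) * ∑ k ∈ Finset.range m, ‖w k‖^2 = 2^m * Es := by linarith
    exact mul_left_cancel₀ hM.ne' this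
end

section
/- Let m' ≥ 1, m'' ≥ 1, m = m' + m'', M' = 2^{m'}, M'' = 2^{m''}, M = M'·M''. Let X' and X'' be one-dimensional input alphabets (an M'×1 and an M''×1 real matrix), and let X = X' ⊗ X'' be their ordered direct product (a two-dimensional M×2 alphabet), and assume the M rows of X are distinct. Then, for any binary labeling L of order m, the constellation [X, L, U_M] is first-order optimal if and only if there exist binary labelings L' of order m' and L'' of order m'' such that both [X', L', U_{M'}] and [X'', L'', U_{M''}] are first-order optimal and L coincides with L' ⊗ L'' up to a permutation of its m columns. -/
/-- The rows of the ordered direct product `X' ⊗ X''` of two one-dimensional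
alphabets: row `M''·l + j` is `[x'_l, x''_j] ∈ ℝ²`. -/
noncomputable def prodX (M'' : ℕ) (x' x'' : ℕ → ℝ) (i : ℕ) :
    EuclideanSpace ℝ (Fin 2) :=
  (WithLp.equiv 2 (Fin 2 → ℝ)).symm ![x' (i / M''), x'' (i % M'')]

/-- The ordered direct product `L' ⊗ L''` of two labelings: the codeword of row
`M''·l + j` is the concatenation of codewords `c'_l` and `c''_j`. -/
def prodLab (m' M'' : ℕ) (c' c'' : ℕ → ℕ → Bool) (i k : ℕ) : Bool :=
  if k < m' then c' (i / M'') k else c'' (i % M'') (k - m')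

/-- sign of a bit -/
noncomputable def sg (b : Bool) : ℝ := if b then -1 else 1

lemma sum_cons {n : ℕ} (F : (Fin (n+1) → Bool) → ℝ) :
    ∑ p, F p = ∑ p : Fin n → Bool, (F (Fin.cons true p) + F (Fin.cons false p)) := by
  rw [← (Fin.consEquiv (fun _ : Fin (n+1) => Bool)).sum_comp, Fintype.sum_prod_type]
  simp [Fin.consEquiv, Finset.sum_add_distrib]

lemma mom1 (n : ℕ) (a : Fin n → ℝ) :
    ∑ p : Fin n → Bool, ∑ k, sg (p k) * a k = 0 := by
  induction n with
  | zero => simp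
  | succ n ih =>
    rw [sum_cons]
    have := ih (fun k => a k.succ)
    simp only [Fin.sum_univ_succ, Fin.cons_zero, Fin.cons_succ]
    have h2 : ∀ p : Fin n → Bool, (sg true * a 0 + ∑ k, sg (p k) * a k.succ) +
      (sg false * a 0 + ∑ k, sg (p k) * a k.succ) = 2 * ∑ k, sg (p k) * a k.succ := by
      intro p; simp [sg]; ring
    simp only [h2, ← Finset.mul_sum, this, mul_zero]

lemma mom11 (n : ℕ) (a b : Fin n → ℝ) :
    ∑ p : Fin n → Bool, (∑ k, sg (p k) * a k) * (∑ k, sg (p k) * b k)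
      = 2^n * ∑ k, a k * b k := by
  induction n with
  | zero => simp
  | succ n ih =>
    rw [sum_cons]
    have := ih (fun k => a k.succ) (fun k => b k.succ)
    simp only [Fin.sum_univ_succ, Fin.cons_zero, Fin.cons_succ]
    have h2 : ∀ p : Fin n → Bool,
      (sg true * a 0 + ∑ k, sg (p k) * a k.succ) * (sg true * b 0 + ∑ k, sg (p k) * b k.succ) +
      (sg false * a 0 + ∑ k, sg (p k) * a k.succ) * (sg false * b 0 + ∑ k, sg (p k) * b k.succ)
       = 2 * ((∑ k, sg (p k) * a k.succ) * (∑ k, sg (p k) * b k.succ)) + 2 * (a 0 * b 0) := by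
      intro p; simp [sg]; ring
    simp only [h2, Finset.sum_add_distrib, ← Finset.mul_sum, this]
    simp
    ring

lemma mom22 (n : ℕ) (a b : Fin n → ℝ) :
    ∑ p : Fin n → Bool, (∑ k, sg (p k) * a k)^2 * (∑ k, sg (p k) * b k)^2
      = 2^n * ((∑ k, a k * a k) * (∑ k, b k * b k) + 2 * (∑ k, a k * b k)^2
        - 2 * ∑ k, (a k * b k)^2) := by
  induction n with
  | zero => simp
  | succ n ih =>
    rw [sum_cons]
    have h22 := ih (fun k => a k.succ) (fun k => b k.succ)
    have haa := mom11 n (fun k => a k.succ) (fun k => a k.succ)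
    have hbb := mom11 n (fun k => b k.succ) (fun k => b k.succ)
    have hab := mom11 n (fun k => a k.succ) (fun k => b k.succ)
    simp only [Fin.sum_univ_succ, Fin.cons_zero, Fin.cons_succ]
    have h2 : ∀ p : Fin n → Bool,
      (sg true * a 0 + ∑ k, sg (p k) * a k.succ)^2 * (sg true * b 0 + ∑ k, sg (p k) * b k.succ)^2 +
      (sg false * a 0 + ∑ k, sg (p k) * a k.succ)^2 * (sg false * b 0 + ∑ k, sg (p k) * b k.succ)^2
       = 2 * ((∑ k, sg (p k) * a k.succ)^2 * (∑ k, sg (p k) * b k.succ)^2)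
       + 2 * (b 0)^2 * ((∑ k, sg (p k) * a k.succ) * (∑ k, sg (p k) * a k.succ))
       + 2 * (a 0)^2 * ((∑ k, sg (p k) * b k.succ) * (∑ k, sg (p k) * b k.succ))
       + 8 * (a 0 * b 0) * ((∑ k, sg (p k) * a k.succ) * (∑ k, sg (p k) * b k.succ))
       + 2 * (a 0 * b 0)^2 := by
      intro p; simp [sg]; ring
    simp only [h2, Finset.sum_add_distrib, ← Finset.mul_sum, h22, haa, hbb, hab]
    simp
    ring

section bes
variable {ι : Type*} [Fintype ι] {n : ℕ} (e : ι ≃ (Fin n → Bool)) (x : ι → ℝ)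

/-- correlation coefficient -/
noncomputable def cf (k : Fin n) : ℝ := (2^n : ℝ)⁻¹ * ∑ i, sg (e i k) * x i

lemma bessel : ∑ i, x i ^ 2 - 2^n * ∑ k, cf e x k ^ 2
    = ∑ i, (x i - ∑ k, sg (e i k) * cf e x k)^2 := by
  have h1 : ∑ i, (∑ k, sg (e i k) * cf e x k) * (∑ k, sg (e i k) * cf e x k)
      = 2^n * ∑ k, cf e x k * cf e x k := by
    rw [← mom11, ← e.sum_comp]
  have h2 : ∑ i, x i * (∑ k, sg (e i k) * cf e x k) = 2^n * ∑ k, cf e x k * cf e x k := by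
    simp only [Finset.mul_sum]
    rw [Finset.sum_comm]
    refine Finset.sum_congr rfl fun k _ => ?_
    have : ∑ i, sg (e i k) * x i = 2^n * cf e x k := by
      unfold cf; field_simp
    calc ∑ i, x i * (sg (e i k) * cf e x k) = (∑ i, sg (e i k) * x i) * cf e x k := by
          rw [Finset.sum_mul]; exact Finset.sum_congr rfl fun i _ => by ring
      _ = _ := by rw [this]; ring
  have h3 : ∀ i, (x i - ∑ k, sg (e i k) * cf e x k)^2 = x i ^ 2
      - 2 * (x i * (∑ k, sg (e i k) * cf e x k))
      + (∑ k, sg (e i k) * cf e x k) * (∑ k, sg (e i k) * cf e x k) := fun i => by ring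
  simp only [h3, Finset.sum_add_distrib, Finset.sum_sub_distrib, ← Finset.mul_sum, h1, h2]
  simp only [pow_two]; ring

lemma bessel_le : 2^n * ∑ k, cf e x k ^ 2 ≤ ∑ i, x i ^ 2 := by
  have := bessel e x
  have h : 0 ≤ ∑ i, (x i - ∑ k, sg (e i k) * cf e x k)^2 :=
    Finset.sum_nonneg fun i _ => sq_nonneg _
  linarith

lemma cf_of (v : Fin n → ℝ) (h : ∀ i, x i = ∑ k, sg (e i k) * v k) (k : Fin n) :
    cf e x k = v k := by
  have := mom11 n (Pi.single k 1) v
  rw [← e.sum_comp] at this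
  simp [Pi.single_apply] at this
  unfold cf
  simp only [h]
  rw [this]; field_simp

lemma bessel_eq : (2^n * ∑ k, cf e x k ^ 2 = ∑ i, x i ^ 2) ↔
    ∃ v : Fin n → ℝ, ∀ i, x i = ∑ k, sg (e i k) * v k := by
  have hb := bessel e x
  constructor
  · intro h
    rw [h, sub_self] at hb
    refine ⟨cf e x, fun i => ?_⟩
    have := (Finset.sum_eq_zero_iff_of_nonneg (fun i _ => sq_nonneg _)).1 hb.symm i
      (Finset.mem_univ i)
    have := pow_eq_zero_iff (two_ne_zero) |>.1 this
    linarith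
  · rintro ⟨v, hv⟩
    have h0 : ∀ k, cf e x k = v k := cf_of e x v hv
    have : ∀ i, x i - ∑ k, sg (e i k) * cf e x k = 0 := by
      intro i; rw [hv i]; simp [h0]
    simp only [this] at hb
    simp at hb
    linarith
end bes

/-- labeling as an equivalence -/
lemma lab_equiv (n : ℕ) (c : ℕ → ℕ → Bool)
    (hc : ∀ i < 2^n, ∀ j < 2^n, (∀ k < n, c i k = c j k) → i = j) :
    ∃ e : Fin (2^n) ≃ (Fin n → Bool), ∀ i k, e i k = c i k := by
  have hb : Function.Bijective (fun (i : Fin (2^n)) (k : Fin n) => c i k) := by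
    rw [Fintype.bijective_iff_injective_and_card]
    refine ⟨fun i j h => ?_, by simp⟩
    apply Fin.ext
    apply hc _ i.2 _ j.2
    intro k hk
    exact congrFun h ⟨k, hk⟩
  exact ⟨Equiv.ofBijective _ hb, fun i k => rfl⟩

lemma logpos : Real.logb 2 (Real.exp 1) ≠ 0 := by
  have : 0 < Real.logb 2 (Real.exp 1) :=
    Real.logb_pos (by norm_num) (Real.one_lt_exp_iff.2 one_pos)
  exact this.ne'

lemma Q_sum (n : ℕ) (c : ℕ → ℕ → Bool) (F : (ℕ → ℝ) → ℝ) :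
    ∑ k ∈ Finset.range n, F (fun i => Qmat n c i k) = ∑ k : Fin n, F (fun i => sg (c i k)) := by
  rw [← Finset.sum_range_reflect, Finset.sum_range]
  refine Finset.sum_congr rfl fun k _ => ?_
  congr 1
  funext i
  have := k.2
  have h : n - 1 - (n - 1 - (k:ℕ)) = k := by omega
  simp [Qmat, sg, h]

lemma foo1 (n : ℕ) (x : ℕ → ℝ) (c : ℕ → ℕ → Bool)
    (hc : ∀ i < 2^n, ∀ j < 2^n, (∀ k < n, c i k = c j k) → i = j)
    (hx : ∃ i < 2^n, x i ≠ 0) :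
    (Real.logb 2 (Real.exp 1) /
            ((2^n : ℝ)⁻¹ * ∑ i ∈ Finset.range (2^n), x i ^ 2)) *
          ∑ k ∈ Finset.range n,
            ((2^n : ℝ)⁻¹ * ∑ i ∈ Finset.range (2^n), Qmat n c i k * x i)^2
          = Real.logb 2 (Real.exp 1) ↔
    ∃ v : Fin n → ℝ, ∀ i < 2^n, x i = ∑ k : Fin n, sg (c i k) * v k := by
  obtain ⟨e, he⟩ := lab_equiv n c hc
  have h0 := logpos
  rw [Q_sum n c (fun q => ((2^n : ℝ)⁻¹ * ∑ i ∈ Finset.range (2^n), q i * x i)^2)]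
  have hE : 0 < ∑ i : Fin (2^n), x i ^ 2 := by
    obtain ⟨i, hi, hxi⟩ := hx
    refine Finset.sum_pos' (fun i _ => sq_nonneg _) ⟨⟨i, hi⟩, Finset.mem_univ _, ?_⟩
    positivity
  simp only [Finset.sum_range]
  have hb := bessel_eq e (fun i => x i)
  simp only [cf, he] at hb
  have : (∃ v : Fin n → ℝ, ∀ i < 2^n, x i = ∑ k : Fin n, sg (c i k) * v k) ↔
    (∃ v : Fin n → ℝ, ∀ i : Fin (2^n), x i = ∑ k : Fin n, sg (c i k) * v k) :=
    ⟨fun ⟨v, hv⟩ => ⟨v, fun i => hv i i.2⟩, fun ⟨v, hv⟩ => ⟨v, fun i hi => hv ⟨i, hi⟩⟩⟩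
  rw [this, ← hb]
  generalize (∑ i : Fin (2^n), x i ^ 2) = E at hE
  generalize (∑ k : Fin n, ((2^n : ℝ)⁻¹ * ∑ i : Fin (2^n), sg (c i k) * x i)^2) = A
  have hE' := hE.ne'
  field_simp

lemma foo2 (n M : ℕ) (x y : ℕ → ℝ) (c : ℕ → ℕ → Bool)
    (hc : ∀ i < 2^n, ∀ j < 2^n, (∀ k < n, c i k = c j k) → i = j)
    (hx : ∃ i < 2^n, x (i / M) ≠ 0) :
    (Real.logb 2 (Real.exp 1) /
        ((2^n : ℝ)⁻¹ *
          ∑ i ∈ Finset.range (2^n), ‖prodX M x y i‖^2)) *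
      ∑ k ∈ Finset.range n,
        ‖(2^n : ℝ)⁻¹ •
          ∑ i ∈ Finset.range (2^n),
            Qmat n c i k • prodX M x y i‖^2
      = Real.logb 2 (Real.exp 1) ↔
    ∃ v w : Fin n → ℝ, ∀ i < 2^n, x (i / M) = ∑ k : Fin n, sg (c i k) * v k ∧
      y (i % M) = ∑ k : Fin n, sg (c i k) * w k := by
  obtain ⟨e, he⟩ := lab_equiv n c hc
  have h0 := logpos
  rw [Q_sum n c (fun q => ‖(2^n : ℝ)⁻¹ • ∑ i ∈ Finset.range (2^n), q i • prodX M x y i‖^2)]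
  have hn : ∀ i, ‖prodX M x y i‖^2 = x (i/M) ^2 + y (i % M)^2 := by
    intro i; simp [EuclideanSpace.norm_sq_eq, prodX]
  have hn2 : ∀ k, ‖(2^n : ℝ)⁻¹ • ∑ i ∈ Finset.range (2^n), sg (c i k) • prodX M x y i‖^2
      = ((2^n : ℝ)⁻¹ * ∑ i ∈ Finset.range (2^n), sg (c i k) * x (i/M))^2
       + ((2^n : ℝ)⁻¹ * ∑ i ∈ Finset.range (2^n), sg (c i k) * y (i%M))^2 := by
    intro k; rw [EuclideanSpace.norm_sq_eq]; simp [prodX, mul_pow]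
  simp only [hn, hn2, Finset.sum_add_distrib]
  have hE : 0 < ∑ i : Fin (2^n), x (i/M) ^ 2 := by
    obtain ⟨i, hi, hxi⟩ := hx
    refine Finset.sum_pos' (fun i _ => sq_nonneg _) ⟨⟨i, hi⟩, Finset.mem_univ _, ?_⟩
    positivity
  have hF : 0 ≤ ∑ i : Fin (2^n), y (i%M) ^ 2 := Finset.sum_nonneg fun i _ => sq_nonneg _
  simp only [Finset.sum_range]
  have hb := bessel_eq e (fun i => x (i/M))
  have hb' := bessel_eq e (fun i => y (i%M))
  have hl := bessel_le e (fun i => x (i/M))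
  have hl' := bessel_le e (fun i => y (i%M))
  simp only [cf, he] at hb hb' hl hl'
  have : (∃ v w : Fin n → ℝ, ∀ i < 2^n, x (i / M) = ∑ k : Fin n, sg (c i k) * v k ∧
      y (i % M) = ∑ k : Fin n, sg (c i k) * w k) ↔
    (∃ v : Fin n → ℝ, ∀ i : Fin (2^n), x (i/M) = ∑ k : Fin n, sg (c i k) * v k) ∧
    (∃ v : Fin n → ℝ, ∀ i : Fin (2^n), y (i%M) = ∑ k : Fin n, sg (c i k) * v k) :=
    ⟨fun ⟨v, w, hv⟩ => ⟨⟨v, fun i => (hv i i.2).1⟩, ⟨w, fun i => (hv i i.2).2⟩⟩,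
      fun ⟨⟨v, hv⟩, ⟨w, hw⟩⟩ => ⟨v, w, fun i hi => ⟨hv ⟨i, hi⟩, hw ⟨i, hi⟩⟩⟩⟩
  rw [this, ← hb, ← hb']
  generalize (∑ i : Fin (2^n), x (i/M) ^ 2) = E at *
  generalize (∑ i : Fin (2^n), y (i%M) ^ 2) = F at *
  generalize (∑ k : Fin n, ((2^n : ℝ)⁻¹ * ∑ i : Fin (2^n), sg (c i k) * x (i/M))^2) = A at *
  generalize (∑ k : Fin n, ((2^n : ℝ)⁻¹ * ∑ i : Fin (2^n), sg (c i k) * y (i%M))^2) = B at *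
  have hE' : E + F ≠ 0 := by positivity
  field_simp
  constructor
  · intro h; constructor <;> linarith
  · rintro ⟨h1, h2⟩; linarith

/-- counting lemma -/
lemma cnt {n : ℕ} {ι α : Type*} [Fintype α] [DecidableEq α]
    (e : ι ≃ (Fin n → Bool)) (π : ι → α) (hπ : Function.Surjective π)
    (f : α → ℝ) (hf : Function.Injective f) (a : Fin n → ℝ)
    (h : ∀ i, f (π i) = ∑ k, sg (e i k) * a k) (S : Finset (Fin n))
    (hS : ∀ k, k ∉ S → a k = 0) :
    Fintype.card α ≤ 2 ^ S.card ∧ (Fintype.card α = 2 ^ S.card →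
      ∀ i j, π i = π j → ∀ k ∈ S, e i k = e j k) := by
  classical
  let r : (S → Bool) → α := fun p =>
    π (e.symm (fun k => if hk : k ∈ S then p ⟨k, hk⟩ else true))
  have hr : ∀ i, r (fun k => e i k) = π i := by
    intro i
    apply hf
    simp only [r, h]
    refine Finset.sum_congr rfl fun k _ => ?_
    by_cases hk : k ∈ S
    · simp [hk]
    · simp [hS k hk]
  have hsurj : Function.Surjective r := fun l => by
    obtain ⟨i, rfl⟩ := hπ l
    exact ⟨fun k => e i k, hr i⟩
  have hcard : Fintype.card (S → Bool) = 2 ^ S.card := by simp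
  refine ⟨hcard ▸ Fintype.card_le_of_surjective r hsurj, fun hEq i j hij k hk => ?_⟩
  have hbij := (Fintype.bijective_iff_surjective_and_card r).2 ⟨hsurj, by rw [hcard, hEq]⟩
  have : (fun k : S => e i k) = (fun k : S => e j k) := hbij.1 ((hr i).trans (hij.trans (hr j).symm))
  exact congrFun this ⟨k, hk⟩

lemma core (m' m'' : ℕ) (e : Fin (2^m') × Fin (2^m'') ≃ (Fin (m'+m'') → Bool))
    (f : Fin (2^m') → ℝ) (g : Fin (2^m'') → ℝ) (hf : Function.Injective f)
    (hg : Function.Injective g) (a b : Fin (m'+m'') → ℝ)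
    (ha : ∀ i, f i.1 = ∑ k, sg (e i k) * a k)
    (hb : ∀ i, g i.2 = ∑ k, sg (e i k) * b k) :
    ∃ S : Finset (Fin (m'+m'')), S.card = m' ∧ (∀ k, k ∉ S → a k = 0) ∧ (∀ k ∈ S, b k = 0) ∧
      (∀ i j, i.1 = j.1 → ∀ k ∈ S, e i k = e j k) ∧
      (∀ i j, i.2 = j.2 → ∀ k, k ∉ S → e i k = e j k) := by
  classical
  have A1 := mom1 _ a
  have AA := mom11 _ a a
  have BB := mom11 _ b b
  have AB := mom11 _ a b
  have AABB := mom22 _ a b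
  rw [← e.sum_comp] at A1 AA BB AB AABB
  simp only [← ha, ← hb, Fintype.sum_prod_type] at A1 AA BB AB AABB
  simp only [← Finset.mul_sum, ← Finset.sum_mul, Finset.sum_const, Finset.card_univ,
    Fintype.card_fin, nsmul_eq_mul] at A1 AA BB AB AABB
  push_cast at A1 AA BB AB AABB
  have hA : ∑ i, f i = 0 := by
    have : (2^m'' : ℝ) ≠ 0 := by positivity
    simpa [this] using A1
  rw [hA, zero_mul] at AB
  have hab : ∑ k, a k * b k = 0 := by
    have : (2^(m'+m'') : ℝ) ≠ 0 := by positivity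
    rcases mul_eq_zero.1 AB.symm with h | h
    · exact absurd h this
    · exact h
  have hAA : ∑ i, f i ^ 2 = 2^m' * ∑ k, a k * a k := by
    have : (2^m'' : ℝ) ≠ 0 := by positivity
    apply mul_left_cancel₀ this
    rw [pow_add] at AA
    have h5 : ∑ x, f x * (2 ^ m'' * f x) = 2^m'' * ∑ i, f i ^ 2 := by
      rw [Finset.mul_sum]
      exact Finset.sum_congr rfl fun i _ => by ring
    linarith
  have hBB : ∑ i, g i ^ 2 = 2^m'' * ∑ k, b k * b k := by
    have : (2^m' : ℝ) ≠ 0 := by positivity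
    apply mul_left_cancel₀ this
    rw [pow_add] at BB
    simp only [pow_two (g _)]
    linarith
  rw [hAA, hBB, hab, pow_add] at AABB
  have hz : ∑ k, (a k * b k)^2 = 0 := by
    have : (2^m' * 2^m'' : ℝ) ≠ 0 := by positivity
    apply mul_left_cancel₀ this
    linarith
  have hz' : ∀ k, a k * b k = 0 := fun k => by
    have := (Finset.sum_eq_zero_iff_of_nonneg (fun i _ => sq_nonneg _)).1 hz k
      (Finset.mem_univ k)
    exact pow_eq_zero_iff (two_ne_zero) |>.1 this
  let S : Finset (Fin (m'+m'')) := Finset.univ.filter fun k => a k ≠ 0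
  have hSa : ∀ k, k ∉ S → a k = 0 := fun k hk => by simpa [S] using hk
  have hSb : ∀ k ∈ S, b k = 0 := fun k hk => by
    have h1 : a k ≠ 0 := by simpa [S] using hk
    exact (mul_eq_zero.1 (hz' k)).resolve_left h1
  have c1 := cnt e Prod.fst Prod.fst_surjective f hf a ha S hSa
  have c2 := cnt e Prod.snd Prod.snd_surjective g hg b hb Sᶜ (fun k hk => hSb k (by simpa using hk))
  have l1 : m' ≤ S.card := by
    have := c1.1
    rw [Fintype.card_fin] at this
    exact (Nat.pow_le_pow_iff_right (by norm_num)).1 this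
  have l2 : m'' ≤ Sᶜ.card := by
    have := c2.1
    rw [Fintype.card_fin] at this
    exact (Nat.pow_le_pow_iff_right (by norm_num)).1 this
  have l3 : S.card + Sᶜ.card = m' + m'' := by
    rw [Finset.card_add_card_compl, Fintype.card_fin]
  have s1 : S.card = m' := by omega
  have s2 : Sᶜ.card = m'' := by omega
  refine ⟨S, s1, hSa, hSb, ?_, ?_⟩
  · exact c1.2 (by rw [s1, Fintype.card_fin])
  · intro i j hij k hk
    exact c2.2 (by rw [s2, Fintype.card_fin]) i j hij k (by simpa using hk)

/-- `core` on natural number indices -/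
lemma core_nat (m' m'' : ℕ) (x' x'' : ℕ → ℝ) (c : ℕ → ℕ → Bool)
    (hc : ∀ i < 2^(m'+m''), ∀ j < 2^(m'+m''),
      (∀ k < m'+m'', c i k = c j k) → i = j)
    (hf : ∀ i < 2^m', ∀ j < 2^m', x' i = x' j → i = j)
    (hg : ∀ i < 2^m'', ∀ j < 2^m'', x'' i = x'' j → i = j)
    (v w : Fin (m'+m'') → ℝ)
    (h : ∀ i < 2^(m'+m''), x' (i / 2^m'') = ∑ k : Fin (m'+m''), sg (c i k) * v k ∧
      x'' (i % 2^m'') = ∑ k : Fin (m'+m''), sg (c i k) * w k) :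
    ∃ S : Finset (Fin (m'+m'')), S.card = m' ∧ (∀ k, k ∉ S → v k = 0) ∧ (∀ k ∈ S, w k = 0) ∧
      (∀ i < 2^(m'+m''), ∀ j < 2^(m'+m''), i / 2^m'' = j / 2^m'' → ∀ k ∈ S, c i k = c j k) ∧
      (∀ i < 2^(m'+m''), ∀ j < 2^(m'+m''), i % 2^m'' = j % 2^m'' → ∀ k, k ∉ S →
        c i k = c j k) := by
  obtain ⟨e, he⟩ := lab_equiv _ c hc
  let E : Fin (2^m') × Fin (2^m'') ≃ Fin (2^(m'+m'')) :=
    finProdFinEquiv.trans (finCongr (pow_add 2 m' m'').symm)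
  have hE : ∀ i, ((E i : Fin _) : ℕ) = i.2 + 2^m'' * i.1 := fun i => by simp [E]
  have hpos : 0 < 2^m'' := by positivity
  have hdiv : ∀ i, ((E i : Fin _) : ℕ) / 2^m'' = i.1 := fun i => by
    rw [hE, Nat.add_mul_div_left _ _ hpos, Nat.div_eq_of_lt i.2.2, zero_add]
  have hmod : ∀ i, ((E i : Fin _) : ℕ) % 2^m'' = i.2 := fun i => by
    rw [hE, Nat.add_mul_mod_self_left, Nat.mod_eq_of_lt i.2.2]
  obtain ⟨S, h1, h2, h3, h4, h5⟩ := core m' m'' (E.trans e) (fun l => x' l) (fun l => x'' l)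
    (fun i j hij => Fin.ext (hf _ i.2 _ j.2 hij)) (fun i j hij => Fin.ext (hg _ i.2 _ j.2 hij)) v w
    (fun i => by have := (h (E i) (E i).2).1; rw [hdiv] at this; simpa [he] using this)
    (fun i => by have := (h (E i) (E i).2).2; rw [hmod] at this; simpa [he] using this)
  refine ⟨S, h1, h2, h3, ?_, ?_⟩
  · intro i hi j hj hij k hk
    have := h4 (E.symm ⟨i, hi⟩) (E.symm ⟨j, hj⟩)
      (by apply Fin.ext; rw [← hdiv, ← hdiv]; simpa using hij) k hk
    simpa [he] using this
  · intro i hi j hj hij k hk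
    have := h5 (E.symm ⟨i, hi⟩) (E.symm ⟨j, hj⟩)
      (by apply Fin.ext; rw [← hmod, ← hmod]; simpa using hij) k hk
    simpa [he] using this

lemma perm_exists (m' m'' : ℕ) (S : Finset (Fin (m'+m''))) (hS : S.card = m') :
    ∃ σ : Equiv.Perm (Fin (m'+m'')), ∀ k, ((σ k : Fin _) : ℕ) < m' ↔ k ∈ S := by
  classical
  have hcard : Fintype.card {k // k ∈ S} = Fintype.card {k : Fin (m'+m'') // (k : ℕ) < m'} := by
    rw [Fintype.card_coe, hS, Fintype.card_subtype]
    have : (Finset.univ.filter fun k : Fin (m'+m'') => (k:ℕ) < m')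
        = Finset.univ.map (Fin.castAddEmb m'') := by
      ext k
      simp only [Finset.mem_filter, Finset.mem_univ, true_and, Finset.mem_map]
      constructor
      · intro h; exact ⟨⟨k, h⟩, rfl⟩
      · rintro ⟨j, rfl⟩; exact j.2
    rw [this]; simp
  let e := Fintype.equivOfCardEq hcard
  refine ⟨e.extendSubtype, fun k => ?_⟩
  constructor
  · intro h
    by_contra hk
    exact e.extendSubtype_not_mem k hk h
  · intro h
    exact e.extendSubtype_mem k h

/-- A two-dimensional constellation built as the ordered direct product of two
one-dimensional alphabets, with all rows distinct, is FOO iff both factors admit FOO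
labelings `L'`, `L''` and `L` equals `L' ⊗ L''` up to a column permutation. -/
theorem product_foo_iff (m' m'' : ℕ) (hm' : 1 ≤ m') (hm'' : 1 ≤ m'')
    (x' x'' : ℕ → ℝ) (c : ℕ → ℕ → Bool)
    (hc : ∀ i < 2^(m'+m''), ∀ j < 2^(m'+m''),
      (∀ k < m'+m'', c i k = c j k) → i = j)
    (hdist : ∀ i < 2^(m'+m''), ∀ j < 2^(m'+m''),
      prodX (2^m'') x' x'' i = prodX (2^m'') x' x'' j → i = j) :
    (Real.logb 2 (Real.exp 1) /
        ((2^(m'+m'') : ℝ)⁻¹ *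
          ∑ i ∈ Finset.range (2^(m'+m'')), ‖prodX (2^m'') x' x'' i‖^2)) *
      ∑ k ∈ Finset.range (m'+m''),
        ‖(2^(m'+m'') : ℝ)⁻¹ •
          ∑ i ∈ Finset.range (2^(m'+m'')),
            Qmat (m'+m'') c i k • prodX (2^m'') x' x'' i‖^2
      = Real.logb 2 (Real.exp 1)
    ↔ ∃ c' c'' : ℕ → ℕ → Bool,
        (∀ i < 2^m', ∀ j < 2^m', (∀ k < m', c' i k = c' j k) → i = j) ∧
        (∀ i < 2^m'', ∀ j < 2^m'', (∀ k < m'', c'' i k = c'' j k) → i = j) ∧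
        (Real.logb 2 (Real.exp 1) /
            ((2^m' : ℝ)⁻¹ * ∑ i ∈ Finset.range (2^m'), x' i ^ 2)) *
          ∑ k ∈ Finset.range m',
            ((2^m' : ℝ)⁻¹ * ∑ i ∈ Finset.range (2^m'), Qmat m' c' i k * x' i)^2
          = Real.logb 2 (Real.exp 1) ∧
        (Real.logb 2 (Real.exp 1) /
            ((2^m'' : ℝ)⁻¹ * ∑ i ∈ Finset.range (2^m''), x'' i ^ 2)) *
          ∑ k ∈ Finset.range m'',
            ((2^m'' : ℝ)⁻¹ * ∑ i ∈ Finset.range (2^m''), Qmat m'' c'' i k * x'' i)^2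
          = Real.logb 2 (Real.exp 1) ∧
        ∃ σ : Equiv.Perm (Fin (m'+m'')),
          ∀ i < 2^(m'+m''), ∀ k : Fin (m'+m''),
            c i (k : ℕ) = prodLab m' (2^m'') c' c'' i ((σ k : Fin (m'+m'')) : ℕ) := by
  have hp1 : 0 < 2^m' := by positivity
  have hp2 : 0 < 2^m'' := by positivity
  have hp : 2^(m'+m'') = 2^m' * 2^m'' := pow_add 2 m' m''
  have hlt : ∀ l < 2^m', ∀ j < 2^m'', l * 2^m'' + j < 2^(m'+m'') := by
    intro l hl j hj
    rw [hp]
    nlinarith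
  have hdiv : ∀ l, ∀ j < 2^m'', (l * 2^m'' + j) / 2^m'' = l := by
    intro l j hj
    rw [mul_comm, Nat.mul_add_div hp2, Nat.div_eq_of_lt hj, add_zero]
  have hmod : ∀ l, ∀ j < 2^m'', (l * 2^m'' + j) % 2^m'' = j := by
    intro l j hj
    rw [mul_comm, Nat.mul_add_mod, Nat.mod_eq_of_lt hj]
  have hf : ∀ i < 2^m', ∀ j < 2^m', x' i = x' j → i = j := by
    intro i hi j hj hij
    have := hdist _ (hlt i hi 0 hp2) _ (hlt j hj 0 hp2)
      (by simp only [prodX, hdiv _ 0 hp2, hmod _ 0 hp2, hij])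
    have h2 := hdiv i 0 hp2
    rw [this, hdiv j 0 hp2] at h2
    exact h2.symm
  have hg : ∀ i < 2^m'', ∀ j < 2^m'', x'' i = x'' j → i = j := by
    intro i hi j hj hij
    have := hdist _ (hlt 0 hp1 i hi) _ (hlt 0 hp1 j hj)
      (by simp only [prodX, hdiv _ _ hi, hmod _ _ hi, hdiv _ _ hj, hmod _ _ hj, hij])
    simpa using this
  have hnz : ∀ (n : ℕ) (x : ℕ → ℝ), 1 ≤ n → (∀ i < 2^n, ∀ j < 2^n, x i = x j → i = j) →
      ∃ i < 2^n, x i ≠ 0 := by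
    intro n x hn hinj
    by_contra hcon
    push Not at hcon
    have h2 : 1 < 2^n := Nat.one_lt_two_pow (by omega)
    have := hinj 0 (by omega) 1 h2 (by rw [hcon 0 (by omega), hcon 1 h2])
    omega
  have nz1 := hnz m' x' hm' hf
  have nz2 := hnz m'' x'' hm'' hg
  have nz : ∃ i < 2^(m'+m''), x' (i / 2^m'') ≠ 0 := by
    obtain ⟨l, hl, hxl⟩ := nz1
    exact ⟨_, hlt l hl 0 hp2, by rwa [hdiv _ 0 hp2]⟩
  rw [foo2 (m'+m'') (2^m'') x' x'' c hc nz]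
  constructor
  · rintro ⟨v, w, hvw⟩
    obtain ⟨S, hS, hv0, hw0, hS1, hS2⟩ := core_nat m' m'' x' x'' c hc hf hg v w hvw
    obtain ⟨σ, hσ⟩ := perm_exists m' m'' S hS
    let c' : ℕ → ℕ → Bool := fun l k =>
      if h : k < m' + m'' then c (l * 2^m'' + 0) (σ.symm ⟨k, h⟩ : Fin _) else true
    let c'' : ℕ → ℕ → Bool := fun j k =>
      if h : m' + k < m' + m'' then c (0 * 2^m'' + j) (σ.symm ⟨m' + k, h⟩ : Fin _) else true
    have hc'σ : ∀ l (k : Fin (m'+m'')), c' l (σ k : Fin _) = c (l * 2^m'' + 0) k := by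
      intro l k
      simp [c']
    have hc''σ : ∀ j (k : Fin (m'+m'')), m' ≤ ((σ k : Fin _) : ℕ) →
        c'' j (((σ k : Fin _) : ℕ) - m') = c (0 * 2^m'' + j) k := by
      intro j k hk
      have h1 : m' + (((σ k : Fin _) : ℕ) - m') = (σ k : Fin _) := by omega
      simp only [c'', h1]
      simp
    have hc'inj : ∀ i < 2^m', ∀ j < 2^m', (∀ k < m', c' i k = c' j k) → i = j := by
      intro i hi j hj hij
      have := hc _ (hlt i hi 0 hp2) _ (hlt j hj 0 hp2) (by
        intro k hk
        by_cases hkS : (⟨k, hk⟩ : Fin (m'+m'')) ∈ S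
        · have := hij _ ((hσ _).2 hkS)
          rwa [hc'σ, hc'σ] at this
        · exact hS2 _ (hlt i hi 0 hp2) _ (hlt j hj 0 hp2)
            (by rw [hmod _ _ hp2, hmod _ _ hp2]) ⟨k, hk⟩ hkS)
      exact Nat.eq_of_mul_eq_mul_right hp2 this
    have hc''inj : ∀ i < 2^m'', ∀ j < 2^m'', (∀ k < m'', c'' i k = c'' j k) → i = j := by
      intro i hi j hj hij
      have := hc _ (hlt 0 hp1 i hi) _ (hlt 0 hp1 j hj) (by
        intro k hk
        by_cases hkS : (⟨k, hk⟩ : Fin (m'+m'')) ∈ S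
        · exact hS1 _ (hlt 0 hp1 i hi) _ (hlt 0 hp1 j hj)
            (by rw [hdiv _ _ hi, hdiv _ _ hj]) ⟨k, hk⟩ hkS
        · have hge : m' ≤ ((σ ⟨k, hk⟩ : Fin _) : ℕ) := by
            by_contra hcon
            exact hkS ((hσ _).1 (by omega))
          have := hij (((σ ⟨k, hk⟩ : Fin _) : ℕ) - m') (by
            have := (σ ⟨k, hk⟩).2
            omega)
          rwa [hc''σ _ _ hge, hc''σ _ _ hge] at this)
      simpa using this
    refine ⟨c', c'', hc'inj, hc''inj, ?_, ?_, σ, ?_⟩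
    · rw [foo1 m' x' c' hc'inj nz1]
      refine ⟨fun k => v (σ.symm (Fin.castAdd m'' k)), fun l hl => ?_⟩
      have h1 := (hvw _ (hlt l hl 0 hp2)).1
      rw [hdiv _ _ hp2] at h1
      rw [h1, ← σ.symm.sum_comp, Fin.sum_univ_add]
      have h2 : ∀ k : Fin m'', v (σ.symm (Fin.natAdd m' k)) = 0 := by
        intro k
        apply hv0
        rw [← hσ]
        simp
      simp only [h2, mul_zero, Finset.sum_const_zero, add_zero]
      refine Finset.sum_congr rfl fun k _ => ?_
      have h3 := hc'σ l (σ.symm (Fin.castAdd m'' k))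
      rw [add_zero] at h3
      rw [← h3]
      simp
    · rw [foo1 m'' x'' c'' hc''inj nz2]
      refine ⟨fun k => w (σ.symm (Fin.natAdd m' k)), fun l hl => ?_⟩
      have h1 := (hvw _ (hlt 0 hp1 l hl)).2
      rw [hmod _ _ hl] at h1
      rw [h1, ← σ.symm.sum_comp, Fin.sum_univ_add]
      have h2 : ∀ k : Fin m', w (σ.symm (Fin.castAdd m'' k)) = 0 := by
        intro k
        apply hw0
        rw [← hσ]
        simp
      simp only [h2, mul_zero, Finset.sum_const_zero, zero_add]
      refine Finset.sum_congr rfl fun k _ => ?_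
      rw [← hc''σ _ _ (by simp)]
      simp
    · intro i hi k
      have hi1 : i / 2^m'' < 2^m' := by
        rw [Nat.div_lt_iff_lt_mul hp2, ← hp]; exact hi
      have hi2 : i % 2^m'' < 2^m'' := Nat.mod_lt _ hp2
      unfold prodLab
      by_cases hk : ((σ k : Fin _) : ℕ) < m'
      · rw [if_pos hk, hc'σ]
        exact hS1 _ hi _ (hlt _ hi1 0 hp2) (by rw [hdiv _ _ hp2]) k ((hσ k).1 hk)
      · rw [if_neg hk, hc''σ _ _ (by omega)]
        exact hS2 _ hi _ (hlt 0 hp1 _ hi2) (by rw [hmod _ _ hi2]) k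
          (fun h => hk ((hσ k).2 h))
  · rintro ⟨c', c'', hc'inj, hc''inj, hF', hF'', σ, hσ⟩
    rw [foo1 m' x' c' hc'inj nz1] at hF'
    rw [foo1 m'' x'' c'' hc''inj nz2] at hF''
    obtain ⟨v, hv⟩ := hF'
    obtain ⟨w, hw⟩ := hF''
    refine ⟨fun k => Fin.append v (fun _ => (0:ℝ)) (σ k),
      fun k => Fin.append (fun _ => (0:ℝ)) w (σ k), fun i hi => ?_⟩
    have hi1 : i / 2^m'' < 2^m' := by
      rw [Nat.div_lt_iff_lt_mul hp2, ← hp]; exact hi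
    have hi2 : i % 2^m'' < 2^m'' := Nat.mod_lt _ hp2
    constructor
    · rw [hv _ hi1, ← σ.symm.sum_comp, Fin.sum_univ_add]
      simp [hσ i hi, prodLab]
    · rw [hw _ hi2, ← σ.symm.sum_comp, Fin.sum_univ_add]
      simp [hσ i hi, prodLab]
end
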